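/- (Lemma 1, conflation) A formula α ∈ L_PrŁ²Δ is Pr_Ł²Δ valid (i.e., e₁(α)=1 and e₂(α)=0 in every Pr_Ł²Δ model) if and only if e₁(α)=1 in every Pr_Ł²Δ model. -/

import Mathlib

inductive BD : Type where
  | var : ℕ → BD
  | neg : BD → BD
  | and : BD → BD → BD
  | or  : BD → BD → BD

structure BDModel (W : Type) where
  vpos : ℕ → Set W
  vneg : ℕ → Set W

mutual
  def suppT {W : Type} (M : BDModel W) : BD → W → Prop
    | .var p, w => w ∈ M.vpos p
    | .neg φ, w => suppF M φ w
    | .and φ χ, w => suppT M φ w ∧ suppT M χ w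
    | .or φ χ, w => suppT M φ w ∨ suppT M χ w
  def suppF {W : Type} (M : BDModel W) : BD → W → Prop
    | .var p, w => w ∈ M.vneg p
    | .neg φ, w => suppT M φ w
    | .and φ χ, w => suppF M φ w ∨ suppF M χ w
    | .or φ χ, w => suppF M φ w ∧ suppF M χ w
end

def extP {W : Type} (M : BDModel W) (φ : BD) : Set W := {w | suppT M φ w}
def extN {W : Type} (M : BDModel W) (φ : BD) : Set W := {w | suppF M φ w}

/-- A BD model (on a nonempty carrier) together with a ±-probability. -/
structure PrModel (W : Type) [Nonempty W] where
  M : BDModel W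
  mu : Set W → ℝ
  mu_mem : ∀ X : Set W, mu X ∈ Set.Icc (0:ℝ) 1
  mon : ∀ X Y : Set W, X ⊆ Y → mu X ≤ mu Y
  negp : ∀ φ : BD, mu (extN M φ) = mu (extP M (.neg φ))
  ex : ∀ φ χ : BD,
    mu (extP M (.or φ χ)) = mu (extP M φ) + mu (extP M χ) - mu (extP M (.and φ χ))

/-- The language L_PrŁ²Δ: α ::= Pr φ | ¬α | ∼α | Δα | (α→α). -/
inductive PrF : Type where
  | pr : BD → PrF
  | neg : PrF → PrF
  | snot : PrF → PrF
  | delta : PrF → PrF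
  | imp : PrF → PrF → PrF

open Classical in
mutual
  /-- Support of truth e₁ in a Pr_Ł²Δ model. -/
  noncomputable def pe1 {W : Type} [Nonempty W] (P : PrModel W) : PrF → ℝ
    | .pr φ => P.mu (extP P.M φ)
    | .neg α => pe2 P α
    | .snot α => 1 - pe1 P α
    | .delta α => if pe1 P α = 1 then 1 else 0
    | .imp α β => min 1 (1 - pe1 P α + pe1 P β)
  /-- Support of falsity e₂ in a Pr_Ł²Δ model. -/
  noncomputable def pe2 {W : Type} [Nonempty W] (P : PrModel W) : PrF → ℝ
    | .pr φ => P.mu (extN P.M φ)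
    | .neg α => pe1 P α
    | .snot α => 1 - pe2 P α
    | .delta α => if pe2 P α = 0 then 0 else 1
    | .imp α β => max 0 (pe2 P β - pe2 P α)
end

/-- Pr_Ł²Δ validity: value (1,0) in every model. -/
def PrValid (α : PrF) : Prop :=
  ∀ (W : Type) (_ : Nonempty W) (P : PrModel W), pe1 P α = 1 ∧ pe2 P α = 0

/-- The ¬-normal form transformation pushing ¬ to modal atoms. -/
def PrF.nnf : PrF → PrF
  | .pr φ => .pr φ
  | .snot α => .snot α.nnf
  | .delta α => .delta α.nnf
  | .imp α β => .imp α.nnf β.nnf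
  | .neg (.pr φ) => .pr (.neg φ)
  | .neg (.neg α) => α.nnf
  | .neg (.snot α) => .snot (PrF.nnf (.neg α))
  | .neg (.imp α β) => .snot (.imp (PrF.nnf (.neg β)) (PrF.nnf (.neg α)))
  | .neg (.delta α) => .snot (.delta (.snot (PrF.nnf (.neg α))))

/-- The conflation dual of a BD model: positive and negative valuations are swapped and
complemented. -/
def BDModel.conflation {W : Type} (M : BDModel W) : BDModel W where
  vpos p := (M.vneg p)ᶜ
  vneg p := (M.vpos p)ᶜ

theorem supp_conflation {W : Type} (M : BDModel W) (φ : BD) (w : W) :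
    (suppT M.conflation φ w ↔ ¬ suppF M φ w) ∧ (suppF M.conflation φ w ↔ ¬ suppT M φ w) := by
  induction φ with
  | var p => simp [suppT, suppF, BDModel.conflation]
  | neg φ ih => simp only [suppT, suppF]; tauto
  | and φ χ ihφ ihχ => simp only [suppT, suppF]; tauto
  | or φ χ ihφ ihχ => simp only [suppT, suppF]; tauto

theorem extP_conflation {W : Type} (M : BDModel W) (φ : BD) :
    extP M.conflation φ = (extN M φ)ᶜ :=
  Set.ext fun w => (supp_conflation M φ w).1

theorem extN_conflation {W : Type} (M : BDModel W) (φ : BD) :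
    extN M.conflation φ = (extP M φ)ᶜ :=
  Set.ext fun w => (supp_conflation M φ w).2

theorem extP_neg {W : Type} (M : BDModel W) (φ : BD) : extP M (.neg φ) = extN M φ := by
  simp [extP, extN, suppT]

/-- The conflation dual of a model with a ±-probability: the measure of a set becomes one minus
the measure of its complement. -/
def PrModel.conflation {W : Type} [Nonempty W] (P : PrModel W) : PrModel W where
  M := P.M.conflation
  mu X := 1 - P.mu Xᶜ
  mu_mem X := by
    have h := P.mu_mem Xᶜ
    exact ⟨by linarith [h.2], by linarith [h.1]⟩
  mon X Y h := by
    have := P.mon _ _ (Set.compl_subset_compl.mpr h)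
    linarith
  negp φ := by rw [extP_neg]
  ex φ χ := by
    have h := P.ex (.neg φ) (.neg χ)
    have hor : extP P.M (.or (.neg φ) (.neg χ)) = extN P.M (.and φ χ) := by
      simp [extP, extN, suppT, suppF]
    have hand : extP P.M (.and (.neg φ) (.neg χ)) = extN P.M (.or φ χ) := by
      simp [extP, extN, suppT, suppF]
    rw [hor, hand, extP_neg, extP_neg] at h
    simp only [extP_conflation, compl_compl]
    linarith

theorem pe_conflation {W : Type} [Nonempty W] (P : PrModel W) (α : PrF) :
    pe1 P.conflation α = 1 - pe2 P α ∧ pe2 P.conflation α = 1 - pe1 P α := by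
  induction α with
  | pr φ =>
    have hP := extP_conflation P.M φ
    have hN := extN_conflation P.M φ
    simp [pe1, pe2, PrModel.conflation, hP, hN]
  | neg α ih => exact ⟨by simp only [pe1, pe2, ih.2], by simp only [pe1, pe2, ih.1]⟩
  | snot α ih => simp [pe1, pe2, ih.1, ih.2]
  | delta α ih =>
    have h : (1 - pe1 P α = 0) ↔ pe1 P α = 1 := by rw [sub_eq_zero, eq_comm]
    simp only [pe1, pe2, ih.1, ih.2, h, sub_eq_self]
    constructor <;> split_ifs <;> norm_num
  | imp α β ihα ihβ =>
    simp only [pe1, pe2, ihα.1, ihα.2, ihβ.1, ihβ.2]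
    constructor <;> grind

/-- Lemma 1 (conflation): α is Pr_Ł²Δ valid iff e₁(α) = 1 in every Pr_Ł²Δ model. -/
theorem PrValid_iff_e1 (α : PrF) :
    PrValid α ↔ ∀ (W : Type) (_ : Nonempty W) (P : PrModel W), pe1 P α = 1 := by
  refine ⟨fun h W hW P => (h W hW P).1, fun h W hW P => ⟨h W hW P, ?_⟩⟩
  have hdual := h W hW P.conflation
  rw [(pe_conflation P α).1] at hdual
  linarith
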